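/- Let V be a variety with 0⃗ and 1⃗ having Boolean factor congruences (BFC). The following are equivalent: (1) there is a first-order L-formula Σ(x⃗,y⃗) of the form ∃w⃗ ⋀ p ≈ q (an existential conjunction of equations) in 2n free variables such that for every A ∈ V and all e⃗, f⃗ ∈ Aⁿ one has e⃗ ⋄_A f⃗ if and only if A ⊨ Σ(e⃗,f⃗); (2) V is stable by complements, i.e. every homomorphism f: A → B between members of V satisfies: e⃗ ⋄_A g⃗ implies f(e⃗) ⋄_B f(g⃗) (applying f componentwise). -/

import Mathlib

open FirstOrder FirstOrder.Language FirstOrder.Language.Structure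

universe u v w

namespace Paper

variable {L : FirstOrder.Language.{0, 0}}

/-- A congruence on an `L`-algebra: an equivalence relation compatible with all operations. -/
structure AlgCon (L : FirstOrder.Language.{0, 0}) (A : Type u) [L.Structure A] where
  r : A → A → Prop
  refl : ∀ a, r a a
  symm : ∀ {a b}, r a b → r b a
  trans : ∀ {a b c}, r a b → r b c → r a c
  compat : ∀ {m : ℕ} (f : L.Functions m) (x y : Fin m → A),
    (∀ i, r (x i) (y i)) → r (funMap f x) (funMap f y)

namespace AlgCon

variable {A : Type u} [L.Structure A]

theorem ext' {c d : AlgCon L A} (h : ∀ a b, c.r a b ↔ d.r a b) : c = d := by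
  cases c; cases d
  simp only [AlgCon.mk.injEq]
  funext a b
  exact propext (h a b)

/-- The identity (diagonal) congruence Δ. -/
def delta (L : FirstOrder.Language.{0, 0}) (A : Type u) [L.Structure A] : AlgCon L A where
  r := Eq
  refl := fun _ => rfl
  symm := fun h => h.symm
  trans := fun h1 h2 => h1.trans h2
  compat := fun f x y h => by rw [funext h]

/-- The universal congruence ∇. -/
def nabla (L : FirstOrder.Language.{0, 0}) (A : Type u) [L.Structure A] : AlgCon L A where
  r := fun _ _ => True
  refl := fun _ => trivial
  symm := fun _ => trivial
  trans := fun _ _ => trivial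
  compat := fun _ _ _ _ => trivial

/-- Meet (intersection) of congruences. -/
def inf (c d : AlgCon L A) : AlgCon L A where
  r := fun a b => c.r a b ∧ d.r a b
  refl := fun a => ⟨c.refl a, d.refl a⟩
  symm := fun h => ⟨c.symm h.1, d.symm h.2⟩
  trans := fun h1 h2 => ⟨c.trans h1.1 h2.1, d.trans h1.2 h2.2⟩
  compat := fun f x y h =>
    ⟨c.compat f x y fun i => (h i).1, d.compat f x y fun i => (h i).2⟩

/-- Relational composition of congruences (as a binary relation). -/
def comp (c d : AlgCon L A) (a b : A) : Prop := ∃ z, c.r a z ∧ d.r z b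

/-- The congruence generated by a binary relation. -/
def conGen (L : FirstOrder.Language.{0, 0}) {A : Type u} [L.Structure A]
    (R : A → A → Prop) : AlgCon L A where
  r := fun a b => ∀ c : AlgCon L A, (∀ x y, R x y → c.r x y) → c.r a b
  refl := fun a _ _ => AlgCon.refl _ a
  symm := fun h c hc => c.symm (h c hc)
  trans := fun h1 h2 c hc => c.trans (h1 c hc) (h2 c hc)
  compat := fun f x y h c hc => c.compat f x y fun i => h i c hc

/-- Join of congruences in the congruence lattice. -/
def sup (c d : AlgCon L A) : AlgCon L A :=
  conGen L (fun a b => c.r a b ∨ d.r a b)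

end AlgCon

/-- The principal congruence θ(a⃗, b⃗) generated by the pairs (aᵢ, bᵢ). -/
def thetaPairs {A : Type u} [L.Structure A] {n : ℕ} (a b : Fin n → A) : AlgCon L A :=
  AlgCon.conGen L (fun x y => ∃ i, x = a i ∧ y = b i)

/-- The congruence θ(S) generated by S × S. -/
def thetaSet {A : Type u} [L.Structure A] (S : Set A) : AlgCon L A :=
  AlgCon.conGen L (fun x y => x ∈ S ∧ y ∈ S)

/-- `[a⃗, b⃗] ∈ θ`: all pairs (aᵢ, bᵢ) belong to the congruence θ. -/
def inCon {A : Type u} [L.Structure A] {n : ℕ} (θ : AlgCon L A) (a b : Fin n → A) : Prop :=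
  ∀ i, θ.r (a i) (b i)

/-- θ and δ are complementary factor congruences: θ ∩ δ = Δ and θ ∘ δ = ∇. -/
def IsComplFC {A : Type u} [L.Structure A] (θ δ : AlgCon L A) : Prop :=
  θ.inf δ = AlgCon.delta L A ∧ ∀ a b : A, θ.comp δ a b

/-- The set of factor congruences of `A`. -/
def FC (L : FirstOrder.Language.{0, 0}) (A : Type u) [L.Structure A] : Set (AlgCon L A) :=
  {θ | ∃ δ, IsComplFC θ δ}

/-- `S` is a Boolean sublattice of the congruence lattice of `A`: it contains Δ and ∇,
is closed under meet and join, is distributive, and every element has a complement in `S`. -/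
def IsBooleanSublattice {A : Type u} [L.Structure A] (S : Set (AlgCon L A)) : Prop :=
  AlgCon.delta L A ∈ S ∧ AlgCon.nabla L A ∈ S ∧
  (∀ θ ∈ S, ∀ δ ∈ S, θ.inf δ ∈ S) ∧
  (∀ θ ∈ S, ∀ δ ∈ S, θ.sup δ ∈ S) ∧
  (∀ θ ∈ S, ∀ δ ∈ S, ∀ γ ∈ S, θ.inf (δ.sup γ) = (θ.inf δ).sup (θ.inf γ)) ∧
  (∀ θ ∈ S, ∃ δ ∈ S, θ.inf δ = AlgCon.delta L A ∧ θ.sup δ = AlgCon.nabla L A)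

/-- An identity (equation between two terms in finitely many variables). -/
structure Identity (L : FirstOrder.Language.{0, 0}) where
  nvars : ℕ
  lhs : L.Term (Fin nvars)
  rhs : L.Term (Fin nvars)

/-- An identity holds in an algebra. -/
def Identity.Holds (e : Identity L) (A : Type u) [L.Structure A] : Prop :=
  ∀ v : Fin e.nvars → A, e.lhs.realize v = e.rhs.realize v

/-- Membership of an algebra in the variety axiomatized by the set of identities `E`. -/
def InVariety (E : Set (Identity L)) (A : Type u) [L.Structure A] : Prop :=
  ∀ e ∈ E, e.Holds A

/-- The data of the closed terms 0₁, …, 0ₙ and 1₁, …, 1ₙ. -/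
structure ZeroOneData (L : FirstOrder.Language.{0, 0}) where
  n : ℕ
  npos : 0 < n
  zero : Fin n → L.Term Empty
  one : Fin n → L.Term Empty

/-- The interpretation of the tuple 0⃗ in an algebra. -/
def ZeroOneData.zeroA (Z : ZeroOneData L) (A : Type u) [L.Structure A] : Fin Z.n → A :=
  fun i => (Z.zero i).realize Empty.elim

/-- The interpretation of the tuple 1⃗ in an algebra. -/
def ZeroOneData.oneA (Z : ZeroOneData L) (A : Type u) [L.Structure A] : Fin Z.n → A :=
  fun i => (Z.one i).realize Empty.elim

/-- `V ⊨ (0⃗ ≈ 1⃗) → x ≈ y`: `V` is a variety with 0⃗ and 1⃗. -/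
def ZeroOneData.Separates (Z : ZeroOneData L) (E : Set (Identity L)) : Prop :=
  ∀ (A : Type u) [L.Structure A], InVariety E A →
    (∀ i, Z.zeroA A i = Z.oneA A i) → Subsingleton A

/-- Product structure on `A × B`. -/
instance prodStructure (A : Type u) (B : Type u) [L.Structure A] [L.Structure B] :
    L.Structure (A × B) where
  funMap := fun f x => (funMap f (fun i => (x i).1), funMap f (fun i => (x i).2))
  RelMap := fun r x => RelMap r (fun i => (x i).1) ∧ RelMap r (fun i => (x i).2)

/-- A witness that `e⃗` is a central element of `A`: an isomorphism
`τ : A ≅ A₁ × A₂` with `A₁, A₂ ∈ V` and `τ(e⃗) = [0⃗, 1⃗]`. -/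
structure CentralWitness (E : Set (Identity L)) (Z : ZeroOneData L)
    (A : Type u) [L.Structure A] (e : Fin Z.n → A) : Type (u + 1) where
  A₁ : Type u
  A₂ : Type u
  [s₁ : L.Structure A₁]
  [s₂ : L.Structure A₂]
  mem₁ : InVariety E A₁
  mem₂ : InVariety E A₂
  iso : A ≃[L] (A₁ × A₂)
  he : ∀ i, iso (e i) = (Z.zeroA A₁ i, Z.oneA A₂ i)

/-- A witness that `e⃗` and `f⃗` are complementary central elements of `A`. -/
structure ComplCentralWitness (E : Set (Identity L)) (Z : ZeroOneData L)
    (A : Type u) [L.Structure A] (e f : Fin Z.n → A) extends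
    CentralWitness E Z A e : Type (u + 1) where
  hf : ∀ i, iso (f i) = (Z.oneA A₁ i, Z.zeroA A₂ i)

/-- `e⃗` is a central element of `A`. -/
def IsCentral (E : Set (Identity L)) (Z : ZeroOneData L)
    (A : Type u) [L.Structure A] (e : Fin Z.n → A) : Prop :=
  Nonempty (CentralWitness E Z A e)

/-- `e⃗ ⋄_A f⃗`: `e⃗` and `f⃗` are complementary central elements of `A`. -/
def CentDiamond (E : Set (Identity L)) (Z : ZeroOneData L)
    (A : Type u) [L.Structure A] (e f : Fin Z.n → A) : Prop :=
  Nonempty (ComplCentralWitness E Z A e f)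

/-- `V` has Boolean factor congruences: for every `A ∈ V`, `FC(A)` is a Boolean
sublattice of `Con(A)`. -/
def HasBFC (E : Set (Identity L)) : Prop :=
  ∀ (A : Type u) [L.Structure A], InVariety E A → IsBooleanSublattice (FC L A)

/-- `V` is stable by complements: every homomorphism between members of `V`
preserves complementary central elements. -/
def StableByComplements (E : Set (Identity L)) (Z : ZeroOneData L) : Prop :=
  ∀ (A B : Type u) [L.Structure A] [L.Structure B], InVariety E A → InVariety E B →
    ∀ (f : A →[L] B) (e g : Fin Z.n → A), CentDiamond E Z A e g →
      CentDiamond E Z B (fun i => f (e i)) (fun i => f (g i))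

/-- A formula is existential: of the form ∃w⃗ ψ with ψ quantifier-free. -/
def IsExistentialForm {α : Type*} (φ : L.Formula α) : Prop :=
  ∃ (m : ℕ) (ψ : L.BoundedFormula α m), ψ.IsQF ∧ φ = ψ.exs

/-- The formula λ(z⃗, x, y) satisfies the condition (R): for all `A, B ∈ V`,
`A × B ⊨ λ([0⃗,1⃗], (a,c), (b,d))` iff `c = d`. -/
def RightFormulaWorks (E : Set (Identity L)) (Z : ZeroOneData L)
    (φ : L.Formula ((Fin Z.n) ⊕ (Fin 2))) : Prop :=
  ∀ (A B : Type u) [L.Structure A] [L.Structure B], InVariety E A → InVariety E B →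
    ∀ (a b : A) (c d : B),
      (φ.Realize (M := A × B)
        (Sum.elim (fun i => (Z.zeroA A i, Z.oneA B i)) ![(a, c), (b, d)]) ↔ c = d)

/-- The formula ρ(z⃗, x, y) satisfies the condition (L): for all `A, B ∈ V`,
`A × B ⊨ ρ([0⃗,1⃗], (a,c), (b,d))` iff `a = b`. -/
def LeftFormulaWorks (E : Set (Identity L)) (Z : ZeroOneData L)
    (φ : L.Formula ((Fin Z.n) ⊕ (Fin 2))) : Prop :=
  ∀ (A B : Type u) [L.Structure A] [L.Structure B], InVariety E A → InVariety E B →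
    ∀ (a b : A) (c d : B),
      (φ.Realize (M := A × B)
        (Sum.elim (fun i => (Z.zeroA A i, Z.oneA B i)) ![(a, c), (b, d)]) ↔ a = b)

/-- `V` has right existentially definable factor congruences. -/
def HasRexDFC (E : Set (Identity L)) (Z : ZeroOneData L) : Prop :=
  HasBFC.{u} E ∧ ∃ φ : L.Formula ((Fin Z.n) ⊕ (Fin 2)),
    IsExistentialForm φ ∧ RightFormulaWorks.{u} E Z φ

/-- `V` has left existentially definable factor congruences. -/
def HasLexDFC (E : Set (Identity L)) (Z : ZeroOneData L) : Prop :=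
  HasBFC.{u} E ∧ ∃ φ : L.Formula ((Fin Z.n) ⊕ (Fin 2)),
    IsExistentialForm φ ∧ LeftFormulaWorks.{u} E Z φ

/-- `(θ, δ)` is the pair of complementary factor congruences associated with the
central element `e⃗`, i.e. `θ ⋄ δ`, `[e⃗,0⃗] ∈ θ` and `[e⃗,1⃗] ∈ δ`. -/
def PairFor (Z : ZeroOneData L) (A : Type u) [L.Structure A]
    (e : Fin Z.n → A) (θ δ : AlgCon L A) : Prop :=
  IsComplFC θ δ ∧ inCon θ e (Z.zeroA A) ∧ inCon δ e (Z.oneA A)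

/-- `a⃗ = e⃗ ∧ f⃗` in the center: `[a⃗,0⃗] ∈ θ_{0,e} ∩ θ_{0,f}` and `[a⃗,1⃗] ∈ θ_{1,e} ∨ θ_{1,f}`. -/
def IsMeetOf (Z : ZeroOneData L) (A : Type u) [L.Structure A]
    (e f a : Fin Z.n → A) : Prop :=
  ∃ θ₀e θ₁e θ₀f θ₁f : AlgCon L A, PairFor Z A e θ₀e θ₁e ∧ PairFor Z A f θ₀f θ₁f ∧
    inCon (θ₀e.inf θ₀f) a (Z.zeroA A) ∧ inCon (θ₁e.sup θ₁f) a (Z.oneA A)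

/-- `a⃗ = e⃗ ∨ f⃗` in the center: `[a⃗,0⃗] ∈ θ_{0,e} ∨ θ_{0,f}` and `[a⃗,1⃗] ∈ θ_{1,e} ∩ θ_{1,f}`. -/
def IsJoinOf (Z : ZeroOneData L) (A : Type u) [L.Structure A]
    (e f a : Fin Z.n → A) : Prop :=
  ∃ θ₀e θ₁e θ₀f θ₁f : AlgCon L A, PairFor Z A e θ₀e θ₁e ∧ PairFor Z A f θ₀f θ₁f ∧
    inCon (θ₀e.sup θ₀f) a (Z.zeroA A) ∧ inCon (θ₁e.inf θ₁f) a (Z.oneA A)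

/-- `a⃗ = e⃗^c` in the center: `[a⃗,1⃗] ∈ θ_{0,e}` and `[a⃗,0⃗] ∈ θ_{1,e}`. -/
def IsComplOf (Z : ZeroOneData L) (A : Type u) [L.Structure A]
    (e a : Fin Z.n → A) : Prop :=
  ∃ θ₀e θ₁e : AlgCon L A, PairFor Z A e θ₀e θ₁e ∧
    inCon θ₀e a (Z.oneA A) ∧ inCon θ₁e a (Z.zeroA A)

section Quotient

variable {A : Type u} [L.Structure A]

/-- The setoid underlying a congruence. -/
def AlgCon.setoid (c : AlgCon L A) : Setoid A :=
  ⟨c.r, ⟨c.refl, fun h => c.symm h, fun h1 h2 => c.trans h1 h2⟩⟩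

/-- The quotient algebra `A/θ`. -/
def ConQuot (c : AlgCon L A) : Type u := Quotient c.setoid

/-- The class of `a` in `A/θ`. -/
def ConQuot.mk (c : AlgCon L A) (a : A) : ConQuot c := Quotient.mk c.setoid a

noncomputable instance conQuotStructure (c : AlgCon L A) : L.Structure (ConQuot c) where
  funMap := fun f x => ConQuot.mk c (funMap f (fun i => (Quotient.out (α := A) (s := c.setoid) (x i))))
  RelMap := fun r x => ∃ as : Fin _ → A, (∀ i, ConQuot.mk c (as i) = x i) ∧ RelMap r as

theorem conQuot_funMap_mk (c : AlgCon L A) {m : ℕ} (f : L.Functions m) (as : Fin m → A) :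
    funMap f (fun i => ConQuot.mk c (as i)) = ConQuot.mk c (funMap f as) := by
  show ConQuot.mk c _ = ConQuot.mk c _
  apply Quotient.sound
  apply c.compat
  intro i
  exact Quotient.mk_out (s := c.setoid) (as i)

/-- The canonical quotient homomorphism `A → A/θ`. -/
def conQuotMk (c : AlgCon L A) : A →[L] ConQuot c where
  toFun := ConQuot.mk c
  map_fun' := fun f x => (conQuot_funMap_mk c f x).symm
  map_rel' := fun _r x h => ⟨x, fun _ => rfl, h⟩

end Quotient

end Paper



open Paper

namespace StabProof

open Filter

variable {L : FirstOrder.Language.{0, 0}}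

/-- Build a homomorphism from compatibility with operations (algebraic language). -/
def mkHom [L.IsAlgebraic] {A B : Type*} [L.Structure A] [L.Structure B] (f : A → B)
    (hf : ∀ (m : ℕ) (g : L.Functions m) (x : Fin m → A),
      f (funMap g x) = funMap g (fun i => f (x i))) : A →[L] B where
  toFun := f
  map_fun' := fun g x => hf _ g x
  map_rel' := fun r => isEmptyElim r

theorem mkHom_apply [L.IsAlgebraic] {A B : Type*} [L.Structure A] [L.Structure B] (f : A → B)
    (hf) (a : A) : mkHom (L := L) f hf a = f a := rfl

theorem hom_zero (Z : ZeroOneData L) {A B : Type u} [L.Structure A] [L.Structure B]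
    (h : A →[L] B) (i) : h (Z.zeroA A i) = Z.zeroA B i := by
  unfold ZeroOneData.zeroA
  rw [← HomClass.realize_term h]
  congr 1
  funext x
  exact x.elim

theorem hom_one (Z : ZeroOneData L) {A B : Type u} [L.Structure A] [L.Structure B]
    (h : A →[L] B) (i) : h (Z.oneA A i) = Z.oneA B i := by
  unfold ZeroOneData.oneA
  rw [← HomClass.realize_term h]
  congr 1
  funext x
  exact x.elim

theorem inVariety_of_sep (E : Set (Identity L)) {A : Type u} [L.Structure A]
    (hA : ∀ x y : A, (∀ (B : Type u) [L.Structure B], InVariety E B →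
      ∀ h : A →[L] B, h x = h y) → x = y) : InVariety E A := by
  intro e he v
  apply hA
  intro B _ hB h
  rw [← HomClass.realize_term h, ← HomClass.realize_term h]
  exact hB e he _

theorem inVariety_of_surj (E : Set (Identity L)) {A B : Type u} [L.Structure A] [L.Structure B]
    (h : A →[L] B) (hs : Function.Surjective h) (hA : InVariety E A) : InVariety E B := by
  intro e he v
  choose w hw using fun k => hs (v k)
  have : v = h ∘ w := by funext k; simp [hw]
  rw [this, HomClass.realize_term h, HomClass.realize_term h, hA e he w]

theorem quot_surj {A : Type u} [L.Structure A] (c : AlgCon L A) :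
    Function.Surjective (conQuotMk c) := fun x => Quotient.exists_rep x

theorem quot_eq {A : Type u} [L.Structure A] (c : AlgCon L A) (a b : A) :
    conQuotMk c a = conQuotMk c b ↔ c.r a b :=
  ⟨fun h => Quotient.exact (s := c.setoid) h, fun h => Quotient.sound (s := c.setoid) h⟩

theorem inVariety_quot (E : Set (Identity L)) {A : Type u} [L.Structure A] (c : AlgCon L A)
    (hA : InVariety E A) : InVariety E (ConQuot c) :=
  inVariety_of_surj E (conQuotMk c) (quot_surj c) hA

/-- Pull back a congruence along a homomorphism. -/
def pull {A B : Type u} [L.Structure A] [L.Structure B] (h : A →[L] B) (c : AlgCon L B) :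
    AlgCon L A where
  r a b := c.r (h a) (h b)
  refl a := c.refl _
  symm h := c.symm h
  trans h1 h2 := c.trans h1 h2
  compat f x y hxy := by
    rw [h.map_fun, h.map_fun]
    exact c.compat f _ _ hxy

/-- The kernel of a homomorphism. -/
def kerC {A B : Type u} [L.Structure A] [L.Structure B] (h : A →[L] B) : AlgCon L A :=
  pull h (AlgCon.delta L B)

/-- Lift a homomorphism to the quotient. -/
noncomputable def liftHom [L.IsAlgebraic] {A B : Type u} [L.Structure A] [L.Structure B] (c : AlgCon L A)
    (h : A →[L] B) (hc : ∀ a b, c.r a b → h a = h b) : ConQuot c →[L] B :=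
  mkHom (Quotient.lift (s := c.setoid) h hc) (by
    intro m g x
    choose w hw using fun k => quot_surj c (x k)
    obtain rfl : (fun k => ConQuot.mk c (w k)) = x := funext hw
    rw [conQuot_funMap_mk]
    exact h.map_fun g w)

theorem liftHom_mk [L.IsAlgebraic] {A B : Type u} [L.Structure A] [L.Structure B]
    (c : AlgCon L A) (h : A →[L] B) (hc) (a : A) :
    liftHom c h hc (conQuotMk c a) = h a := rfl

theorem complFC_iff {A : Type u} [L.Structure A] (θ δ : AlgCon L A) :
    IsComplFC θ δ ↔ (∀ a b, θ.r a b → δ.r a b → a = b) ∧ ∀ a b, ∃ z, θ.r a z ∧ δ.r z b := by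
  constructor
  · rintro ⟨h1, h2⟩
    refine ⟨fun a b hab hab' => ?_, h2⟩
    have : (θ.inf δ).r a b := ⟨hab, hab'⟩
    rw [h1] at this
    exact this
  · rintro ⟨h1, h2⟩
    refine ⟨AlgCon.ext' fun a b => ⟨fun h => h1 a b h.1 h.2, ?_⟩, h2⟩
    intro h
    cases (show a = b from h)
    exact AlgCon.refl _ _

theorem complFC_symm {A : Type u} [L.Structure A] {θ δ : AlgCon L A} (h : IsComplFC θ δ) :
    IsComplFC δ θ := by
  rw [complFC_iff] at h ⊢
  refine ⟨fun a b h1 h2 => h.1 a b h2 h1, fun a b => ?_⟩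
  obtain ⟨z, h1, h2⟩ := h.2 b a
  exact ⟨z, δ.symm h2, θ.symm h1⟩

/-- The congruence form of complementary central elements. -/
structure Dec (Z : ZeroOneData L) (A : Type u) [L.Structure A] (e f : Fin Z.n → A)
    (θ δ : AlgCon L A) : Prop where
  compl : IsComplFC θ δ
  e0 : ∀ i, θ.r (e i) (Z.zeroA A i)
  f1 : ∀ i, θ.r (f i) (Z.oneA A i)
  e1 : ∀ i, δ.r (e i) (Z.oneA A i)
  f0 : ∀ i, δ.r (f i) (Z.zeroA A i)

/-- First projection. -/
def fstHom [L.IsAlgebraic] (A B : Type u) [L.Structure A] [L.Structure B] : A × B →[L] A :=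
  mkHom Prod.fst (fun _ _ _ => rfl)

/-- Second projection. -/
def sndHom [L.IsAlgebraic] (A B : Type u) [L.Structure A] [L.Structure B] : A × B →[L] B :=
  mkHom Prod.snd (fun _ _ _ => rfl)

theorem centDiamond_iff [L.IsAlgebraic] (E : Set (Identity L)) (Z : ZeroOneData L) {A : Type u}
    [L.Structure A] (hA : InVariety E A) (e f : Fin Z.n → A) :
    CentDiamond E Z A e f ↔ ∃ θ δ, Dec Z A e f θ δ := by
  constructor
  · rintro ⟨⟨⟨A₁, A₂, m1, m2, iso, he⟩, hf⟩⟩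
    let h1 : A →[L] A₁ := (fstHom A₁ A₂).comp iso.toHom
    let h2 : A →[L] A₂ := (sndHom A₁ A₂).comp iso.toHom
    have h1a : ∀ a, h1 a = (iso a).1 := fun a => rfl
    have h2a : ∀ a, h2 a = (iso a).2 := fun a => rfl
    refine ⟨kerC h1, kerC h2, (complFC_iff _ _).2 ⟨?_, ?_⟩, ?_, ?_, ?_, ?_⟩
    · intro a b hab hab'
      exact iso.injective (Prod.ext hab hab')
    · intro a b
      refine ⟨iso.symm ((iso a).1, (iso b).2), ?_, ?_⟩
      · show h1 _ = h1 _
        simp [h1a]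
      · show h2 _ = h2 _
        simp [h2a]
    · intro i
      show h1 _ = h1 _
      rw [hom_zero Z h1, h1a, he]
    · intro i
      show h1 _ = h1 _
      rw [hom_one Z h1, h1a]
      exact congrArg Prod.fst (hf i)
    · intro i
      show h2 _ = h2 _
      rw [hom_one Z h2, h2a, he]
    · intro i
      show h2 _ = h2 _
      rw [hom_zero Z h2, h2a]
      exact congrArg Prod.snd (hf i)
  · rintro ⟨θ, δ, hc, e0, f1, e1, f0⟩
    rw [complFC_iff] at hc
    let F : A → ConQuot θ × ConQuot δ := fun a => (conQuotMk θ a, conQuotMk δ a)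
    have hF : Function.Bijective F := by
      constructor
      · intro a b hab
        exact hc.1 a b ((quot_eq _ _ _).1 (congrArg Prod.fst hab))
          ((quot_eq _ _ _).1 (congrArg Prod.snd hab))
      · rintro ⟨x, y⟩
        obtain ⟨a, rfl⟩ := quot_surj θ x
        obtain ⟨b, rfl⟩ := quot_surj δ y
        obtain ⟨z, h1, h2⟩ := hc.2 a b
        exact ⟨z, Prod.ext ((quot_eq _ _ _).2 (θ.symm h1)) ((quot_eq _ _ _).2 h2)⟩
    refine ⟨⟨⟨ConQuot θ, ConQuot δ, inVariety_quot E θ hA, inVariety_quot E δ hA,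
      ⟨Equiv.ofBijective F hF, ?_, fun r => isEmptyElim r⟩, ?_⟩, ?_⟩⟩
    · intro m g x
      exact Prod.ext ((conQuotMk θ).map_fun g x) ((conQuotMk δ).map_fun g x)
    · intro i
      show F (e i) = _
      refine Prod.ext ?_ ?_
      · show conQuotMk θ (e i) = _
        rw [← hom_zero Z (conQuotMk θ), quot_eq]
        exact e0 i
      · show conQuotMk δ (e i) = _
        rw [← hom_one Z (conQuotMk δ), quot_eq]
        exact e1 i
    · intro i
      show F (f i) = _
      refine Prod.ext ?_ ?_
      · show conQuotMk θ (f i) = _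
        rw [← hom_one Z (conQuotMk θ), quot_eq]
        exact f1 i
      · show conQuotMk δ (f i) = _
        rw [← hom_zero Z (conQuotMk δ), quot_eq]
        exact f0 i

/-- Under BFC, if `θ ∨ δ'` identifies 0 and 1 then `θ' ≤ θ` where `θ' ∩ δ' = Δ`. -/
theorem le_of_sup (E : Set (Identity L)) (Z : ZeroOneData L)
    (hsep : ZeroOneData.Separates.{u} Z E) (hbfc : HasBFC.{u} E) {A : Type u} [L.Structure A]
    (hA : InVariety E A) {θ δ θ' : AlgCon L A} (hc : IsComplFC θ δ) (hθ' : θ' ∈ FC L A)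
    (h01 : ∀ i, (θ'.sup δ).r (Z.zeroA A i) (Z.oneA A i)) (a b : A) (hab : θ.r a b) :
    θ'.r a b := by
  have hall : ∀ x y, (θ'.sup δ).r x y := by
    intro x y
    have := hsep (ConQuot (θ'.sup δ)) (inVariety_quot E _ hA) (by
      intro i
      rw [← hom_zero Z (conQuotMk _), ← hom_one Z (conQuotMk _), quot_eq]
      exact h01 i)
    exact (quot_eq _ _ _).1 (this.elim _ _)
  obtain ⟨-, -, -, -, hdist, -⟩ := hbfc A hA
  have h := hdist θ ⟨δ, hc⟩ θ' hθ' δ ⟨θ, complFC_symm hc⟩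
  have h2 : (θ.inf (θ'.sup δ)).r a b := ⟨hab, hall a b⟩
  rw [h] at h2
  apply h2 θ'
  rintro x y (⟨_, h⟩ | h)
  · exact h
  · rw [(complFC_iff _ _).1 hc |>.1 x y h.1 h.2]
    exact AlgCon.refl _ _

/-- Homomorphisms whose kernel is a factor congruence preserve the decompositions. -/
theorem dec_preserve (E : Set (Identity L)) (Z : ZeroOneData L)
    (hsep : ZeroOneData.Separates.{u} Z E) (hbfc : HasBFC.{u} E) {A B : Type u} [L.Structure A]
    [L.Structure B] (hA : InVariety E A) (h : A →[L] B) (hs : Function.Surjective h)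
    {ψ : AlgCon L A} (hψ : IsComplFC (kerC h) ψ) {e f : Fin Z.n → A} {e' f' : Fin Z.n → B}
    (hee : ∀ i, h (e i) = e' i) {θ δ : AlgCon L A} {θ' δ' : AlgCon L B}
    (hd : Dec Z A e f θ δ) (hd' : Dec Z B e' f' θ' δ') :
    (∀ a b, θ.r a b → θ'.r (h a) (h b)) ∧ (∀ a b, δ.r a b → δ'.r (h a) (h b)) := by
  have key : ∀ {θ' δ' : AlgCon L B}, IsComplFC θ' δ' → pull h θ' ∈ FC L A := by
    intro θ' δ' hc
    rw [complFC_iff] at hc hψ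
    refine ⟨(pull h δ').inf ψ, (complFC_iff _ _).2 ⟨?_, ?_⟩⟩
    · rintro a b h1 ⟨h2, h3⟩
      exact hψ.1 a b (hc.1 _ _ h1 h2) h3
    · intro a b
      obtain ⟨w, hw1, hw2⟩ := hc.2 (h a) (h b)
      obtain ⟨w, rfl⟩ := hs w
      obtain ⟨z, hz1, hz2⟩ := hψ.2 w b
      have hz1 : h w = h z := hz1
      rw [hz1] at hw1 hw2
      exact ⟨z, hw1, hw2, hz2⟩
  constructor
  · apply le_of_sup E Z hsep hbfc hA hd.compl (key hd'.compl)
    intro i c hc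
    refine c.trans (b := e i) (hc _ _ (Or.inl ?_)) (hc _ _ (Or.inr (hd.e1 i)))
    show θ'.r (h _) (h _)
    rw [hom_zero Z h, hee]
    exact θ'.symm (hd'.e0 i)
  · apply le_of_sup E Z hsep hbfc hA (complFC_symm hd.compl) (key (complFC_symm hd'.compl))
    intro i c hc
    refine c.trans (b := e i) (hc _ _ (Or.inr (θ.symm (hd.e0 i)))) (hc _ _ (Or.inl ?_))
    show δ'.r (h _) (h _)
    rw [hom_one Z h, hee]
    have hfinal := hd'.e1 i
    exact hfinal

/-- A decomposition operation yields complementary congruences. -/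
theorem dec_of_op (Z : ZeroOneData L) {A : Type u} [L.Structure A] (e f : Fin Z.n → A)
    (d : A → A → A) (h1 : ∀ a, d a a = a) (h2 : ∀ a b c, d (d a b) c = d a c)
    (h3 : ∀ a b c, d a (d b c) = d a c)
    (h4 : ∀ (m : ℕ) (g : L.Functions m) (x y : Fin m → A),
      d (funMap g x) (funMap g y) = funMap g (fun i => d (x i) (y i)))
    (e0 : ∀ i, d (e i) (Z.zeroA A i) = Z.zeroA A i)
    (f1 : ∀ i, d (f i) (Z.oneA A i) = Z.oneA A i)
    (e1 : ∀ i, d (e i) (Z.oneA A i) = e i)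
    (f0 : ∀ i, d (f i) (Z.zeroA A i) = f i) : ∃ θ δ, Dec Z A e f θ δ := by
  let θ : AlgCon L A :=
    { r := fun a b => d a b = b
      refl := h1
      symm := fun {a b} h => by rw [← h, h2, h1]
      trans := fun {a b c} hab hbc => by
        have : d (d a b) c = c := by rw [hab, hbc]
        rwa [h2] at this
      compat := fun g x y h => by rw [h4]; simp only [h] }
  let δ : AlgCon L A :=
    { r := fun a b => d a b = a
      refl := h1
      symm := fun {a b} h => by rw [← h, h3, h1]
      trans := fun {a b c} hab hbc => by
        have : d a (d b c) = a := by rw [hbc, hab]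
        rwa [h3] at this
      compat := fun g x y h => by rw [h4]; simp only [h] }
  refine ⟨θ, δ, (complFC_iff _ _).2 ⟨fun a b h h' => ?_, fun a b => ⟨d a b, ?_, ?_⟩⟩,
    e0, f1, e1, f0⟩
  · exact (show d a b = a from h').symm.trans h
  · exact h3 a a b
  · exact h2 a b b

/-- Pointwise structure on a product. -/
instance piStr {ι : Type u} (B : ι → Type u) [∀ i, L.Structure (B i)] :
    L.Structure (∀ i, B i) where
  funMap := fun g x i => funMap g (fun k => x k i)
  RelMap := fun r x => ∀ i, RelMap r (fun k => x k i)

/-- Evaluation at a coordinate. -/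
def evalHom [L.IsAlgebraic] {ι : Type u} (B : ι → Type u) [∀ i, L.Structure (B i)] (i : ι) :
    (∀ i, B i) →[L] B i := mkHom (fun x => x i) (fun _ _ _ => rfl)

theorem inVariety_pi [L.IsAlgebraic] (E : Set (Identity L)) {ι : Type u} (B : ι → Type u)
    [∀ i, L.Structure (B i)] (hB : ∀ i, InVariety E (B i)) : InVariety E (∀ i, B i) := by
  apply inVariety_of_sep
  intro x y h
  funext i
  exact h (B i) (hB i) (evalHom B i)

/-- The congruence of eventual equality. -/
def evCon {ι : Type u} (l : Filter ι) (B : ι → Type u) [∀ i, L.Structure (B i)] :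
    AlgCon L (∀ i, B i) where
  r x y := ∀ᶠ i in l, x i = y i
  refl _ := Eventually.of_forall fun _ => rfl
  symm h := h.mono fun _ h => h.symm
  trans h1 h2 := by filter_upwards [h1, h2] with i a b using a.trans b
  compat g x y h := by
    filter_upwards [eventually_all.2 h] with i hi
    show funMap g _ = funMap g _
    simp only [hi]

/-- Choosing counterexamples coordinatewise. -/
theorem eventually_forall_of {ι : Type u} {l : Filter ι} {X : ι → Type*}
    [∀ i, Nonempty (X i)] {Q : ∀ i, X i → Prop}
    (h : ∀ p : ∀ i, X i, ∀ᶠ i in l, Q i (p i)) : ∀ᶠ i in l, ∀ a, Q i a := by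
  classical
  let p : ∀ i, X i := fun i =>
    if hi : ∃ a, ¬ Q i a then hi.choose else Classical.arbitrary _
  filter_upwards [h p] with i hi
  by_contra hcon
  push Not at hcon
  have : p i = hcon.choose := dif_pos hcon
  rw [this] at hi
  exact hcon.choose_spec hi

/-- Reduced product. -/
abbrev Red (L : FirstOrder.Language.{0, 0}) {ι : Type u} (l : Filter ι) (B : ι → Type u)
    [∀ i, L.Structure (B i)] : Type u := ConQuot (evCon (L := L) l B)

/-- Class of a sequence in the reduced product. -/
abbrev rmk (L : FirstOrder.Language.{0, 0}) {ι : Type u} (l : Filter ι) (B : ι → Type u)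
    [∀ i, L.Structure (B i)] : (∀ i, B i) →[L] Red L l B := conQuotMk (evCon (L := L) l B)

theorem rmk_eq {ι : Type u} (l : Filter ι) (B : ι → Type u) [∀ i, L.Structure (B i)]
    (x y : ∀ i, B i) : rmk L l B x = rmk L l B y ↔ ∀ᶠ i in l, x i = y i :=
  quot_eq _ _ _

theorem rmk_zero [L.IsAlgebraic] (Z : ZeroOneData L) {ι : Type u} (l : Filter ι)
    (B : ι → Type u) [∀ i, L.Structure (B i)] (i) :
    Z.zeroA (Red L l B) i = rmk L l B (fun k => Z.zeroA (B k) i) := by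
  rw [← hom_zero Z (rmk L l B)]
  congr 1
  funext k
  exact hom_zero Z (evalHom B k) i

theorem rmk_one [L.IsAlgebraic] (Z : ZeroOneData L) {ι : Type u} (l : Filter ι)
    (B : ι → Type u) [∀ i, L.Structure (B i)] (i) :
    Z.oneA (Red L l B) i = rmk L l B (fun k => Z.oneA (B k) i) := by
  rw [← hom_one Z (rmk L l B)]
  congr 1
  funext k
  exact hom_one Z (evalHom B k) i

theorem inVariety_red [L.IsAlgebraic] (E : Set (Identity L)) {ι : Type u} (l : Filter ι)
    (B : ι → Type u) [∀ i, L.Structure (B i)] (hB : ∀ i, InVariety E (B i)) :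
    InVariety E (Red L l B) := inVariety_quot E _ (inVariety_pi E B hB)

/-- Restriction along a section. -/
noncomputable def restr [L.IsAlgebraic] {K J : Type u} (l : Filter K) (l' : Filter J)
    (κ : J → K) (A : K → Type u) [∀ k, L.Structure (A k)] (s : K → J) (hs : ∀ k, κ (s k) = k)
    (ht : Tendsto s l l') : Red L l' (fun j => A (κ j)) →[L] Red L l (fun k => A (κ (s k))) :=
  liftHom _ ((rmk L l (fun k => A (κ (s k)))).comp
    (mkHom (fun (ξ : ∀ j, A (κ j)) k => ξ (s k)) (fun _ _ _ => rfl))) (by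
      intro a b hab
      exact (rmk_eq _ _ _ _).2 (ht.eventually hab))

theorem exists_of_red [L.IsAlgebraic] [Finite (Σ n, L.Functions n)]
    (E : Set (Identity L)) (Z : ZeroOneData L)
    (hsep : ZeroOneData.Separates.{u} Z E) (hbfc : HasBFC.{u} E)
    {K : Type u} (l : Filter K) [l.NeBot] (A : K → Type u) [∀ k, L.Structure (A k)]
    (hA : ∀ k, InVariety E (A k)) (e f : ∀ k, Fin Z.n → A k)
    (H : ∀ (J : Type u) (κ : J → K) (l' : Filter J), Tendsto κ l' l →
      CentDiamond E Z (Red L l' (fun j => A (κ j)))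
        (fun i => rmk L l' (fun j => A (κ j)) (fun j => e (κ j) i))
        (fun i => rmk L l' (fun j => A (κ j)) (fun j => f (κ j) i))) :
    ∃ k, CentDiamond E Z (A k) (e k) (f k) := by
  classical
  have hne : ∀ k, Nonempty (A k) := fun k => ⟨Z.zeroA (A k) ⟨0, Z.npos⟩⟩
  let J : Type u := Σ k, A k × A k
  let l' : Filter J := comap Sigma.fst l
  have H1 := H K (fun k => k) l tendsto_id
  have H2 := H J Sigma.fst l' tendsto_comap
  have VR := inVariety_red E l A hA
  have VJ := inVariety_red E l' (fun j : J => A j.1) (fun j => hA _)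
  obtain ⟨θ, δ, hd⟩ := (centDiamond_iff E Z VR _ _).1 H1
  obtain ⟨θJ, δJ, hdJ⟩ := (centDiamond_iff E Z VJ _ _).1 H2
  obtain ⟨z, hz1, hz2⟩ := ((complFC_iff _ _).1 hdJ.compl).2
    (rmk L l' (fun j : J => A j.1) (fun j => j.2.1))
    (rmk L l' (fun j : J => A j.1) (fun j => j.2.2))
  obtain ⟨ζ, rfl⟩ := quot_surj _ z
  have main : ∀ p q : ∀ k, A k,
      θ.r (rmk L l A p) (rmk L l A (fun k => ζ ⟨k, p k, q k⟩)) ∧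
      δ.r (rmk L l A (fun k => ζ ⟨k, p k, q k⟩)) (rmk L l A q) := by
    intro p q
    let s : K → J := fun k => ⟨k, p k, q k⟩
    have ht : Tendsto s l l' := tendsto_comap_iff.2 tendsto_id
    let h : Red L l' (fun j : J => A j.1) →[L] Red L l A :=
      restr l l' Sigma.fst A s (fun _ => rfl) ht
    have hh : ∀ ξ, h (rmk L l' (fun j : J => A j.1) ξ) = rmk L l A (fun k => ξ (s k)) :=
      fun ξ => rfl
    have hsurj : Function.Surjective h := by
      intro x
      obtain ⟨x, rfl⟩ := quot_surj _ x
      exact ⟨rmk L l' (fun j : J => A j.1) (fun j => x j.1), hh _⟩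
    let l'' : Filter J := l' ⊓ 𝓟 (Set.range s)ᶜ
    let g : Red L l' (fun j : J => A j.1) →[L] Red L l'' (fun j : J => A j.1) :=
      liftHom _ (rmk L l'' (fun j : J => A j.1)) (by
        intro a b hab
        exact (rmk_eq _ _ _ _).2 (hab.filter_mono inf_le_left))
    have hg : ∀ ξ, g (rmk L l' (fun j : J => A j.1) ξ) = rmk L l'' (fun j : J => A j.1) ξ :=
      fun ξ => rfl
    have hψ : IsComplFC (kerC h) (kerC g) := by
      rw [complFC_iff]
      constructor
      · intro a b h1 h2
        obtain ⟨a, rfl⟩ := quot_surj _ a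
        obtain ⟨b, rfl⟩ := quot_surj _ b
        have h1 := (rmk_eq _ _ _ _).1 (show rmk L l A _ = rmk L l A _ from h1)
        have h2 := (rmk_eq _ _ _ _).1
          (show rmk L l'' (fun j : J => A j.1) _ = rmk L l'' (fun j : J => A j.1) _ from h2)
        apply (rmk_eq _ _ _ _).2
        rw [eventually_inf_principal] at h2
        have h1' : ∀ᶠ j in l', a (s (Sigma.fst j)) = b (s (Sigma.fst j)) :=
          tendsto_comap.eventually h1
        filter_upwards [h1', h2] with j hj1 hj2
        by_cases hj : j ∈ Set.range s
        · obtain ⟨k, rfl⟩ := hj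
          exact hj1
        · exact hj2 hj
      · intro a b
        obtain ⟨a, rfl⟩ := quot_surj _ a
        obtain ⟨b, rfl⟩ := quot_surj _ b
        refine ⟨rmk L l' (fun j : J => A j.1)
          (fun j => if j ∈ Set.range s then a j else b j), ?_, ?_⟩
        · show rmk L l A _ = rmk L l A _
          rw [rmk_eq]
          refine Eventually.of_forall fun k => ?_
          exact (if_pos (Set.mem_range_self k)).symm
        · show rmk L l'' (fun j : J => A j.1) _ = rmk L l'' (fun j : J => A j.1) _
          rw [rmk_eq, eventually_inf_principal]
          exact Eventually.of_forall fun j hj => if_neg hj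
    obtain ⟨c1, c2⟩ := dec_preserve E Z hsep hbfc VJ h hsurj hψ (fun i => hh _) hdJ hd
    exact ⟨c1 _ _ hz1, c2 _ _ hz2⟩
  let d : ∀ k, A k → A k → A k := fun k a b => ζ ⟨k, a, b⟩
  have mt : ∀ p q : ∀ k, A k, θ.r (rmk L l A p) (rmk L l A (fun k => d k (p k) (q k))) :=
    fun p q => (main p q).1
  have md : ∀ p q : ∀ k, A k, δ.r (rmk L l A (fun k => d k (p k) (q k))) (rmk L l A q) :=
    fun p q => (main p q).2
  have req : ∀ x y : ∀ k, A k, θ.r (rmk L l A x) (rmk L l A y) →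
      δ.r (rmk L l A x) (rmk L l A y) → ∀ᶠ k in l, x k = y k := by
    intro x y h1 h2
    exact (rmk_eq _ _ _ _).1 (((complFC_iff _ _).1 hd.compl).1 _ _ h1 h2)
  have D1 : ∀ᶠ k in l, ∀ a, d k a a = a :=
    eventually_forall_of fun p => req _ _ (θ.symm (mt p p)) (md p p)
  have D2 : ∀ᶠ k in l, ∀ a : A k × A k × A k,
      d k (d k a.1 a.2.1) a.2.2 = d k a.1 a.2.2 := by
    refine eventually_forall_of fun p => ?_
    let x : ∀ k, A k := fun k => (p k).1
    let y : ∀ k, A k := fun k => (p k).2.1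
    let w : ∀ k, A k := fun k => (p k).2.2
    refine req (fun k => d k (d k (x k) (y k)) (w k)) (fun k => d k (x k) (w k)) ?_ ?_
    · exact θ.trans (θ.symm (mt (fun k => d k (x k) (y k)) w))
        (θ.trans (θ.symm (mt x y)) (mt x w))
    · exact δ.trans (md (fun k => d k (x k) (y k)) w) (δ.symm (md x w))
  have D3 : ∀ᶠ k in l, ∀ a : A k × A k × A k,
      d k a.1 (d k a.2.1 a.2.2) = d k a.1 a.2.2 := by
    refine eventually_forall_of fun p => ?_
    let x : ∀ k, A k := fun k => (p k).1
    let y : ∀ k, A k := fun k => (p k).2.1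
    let w : ∀ k, A k := fun k => (p k).2.2
    refine req (fun k => d k (x k) (d k (y k) (w k))) (fun k => d k (x k) (w k)) ?_ ?_
    · exact θ.trans (θ.symm (mt x (fun k => d k (y k) (w k)))) (mt x w)
    · exact δ.trans (md x (fun k => d k (y k) (w k)))
        (δ.trans (md y w) (δ.symm (md x w)))
  have D4 : ∀ᶠ k in l, ∀ g : (Σ n, L.Functions n),
      ∀ a : (Fin g.1 → A k) × (Fin g.1 → A k),
      d k (funMap g.2 a.1) (funMap g.2 a.2) = funMap g.2 (fun i => d k (a.1 i) (a.2 i)) := by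
    rw [eventually_all]
    intro g
    refine eventually_forall_of fun p => ?_
    let x : Fin g.1 → ∀ k, A k := fun i k => (p k).1 i
    let y : Fin g.1 → ∀ k, A k := fun i k => (p k).2 i
    let w : Fin g.1 → ∀ k, A k := fun i k => d k (x i k) (y i k)
    have h1 : θ.r (rmk L l A (funMap g.2 x)) (rmk L l A (funMap g.2 w)) := by
      rw [(rmk L l A).map_fun, (rmk L l A).map_fun]
      exact θ.compat _ _ _ fun i => mt (x i) (y i)
    have h2 : δ.r (rmk L l A (funMap g.2 w)) (rmk L l A (funMap g.2 y)) := by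
      rw [(rmk L l A).map_fun, (rmk L l A).map_fun]
      exact δ.compat _ _ _ fun i => md (x i) (y i)
    refine req (fun k => d k ((funMap g.2 x : ∀ k, A k) k) ((funMap g.2 y : ∀ k, A k) k))
      (funMap g.2 w) ?_ ?_
    · exact θ.trans (θ.symm (mt (funMap g.2 x) (funMap g.2 y))) h1
    · exact δ.trans (md (funMap g.2 x) (funMap g.2 y)) (δ.symm h2)
  have e0 : ∀ᶠ k in l, ∀ i, d k (e k i) (Z.zeroA (A k) i) = Z.zeroA (A k) i := by
    rw [eventually_all]
    intro i
    have h := hd.e0 i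
    rw [rmk_zero] at h
    exact req _ (fun k => Z.zeroA (A k) i)
      (θ.trans (θ.symm (mt (fun k => e k i) (fun k => Z.zeroA (A k) i))) h) (md _ _)
  have f1 : ∀ᶠ k in l, ∀ i, d k (f k i) (Z.oneA (A k) i) = Z.oneA (A k) i := by
    rw [eventually_all]
    intro i
    have h := hd.f1 i
    rw [rmk_one] at h
    exact req _ (fun k => Z.oneA (A k) i)
      (θ.trans (θ.symm (mt (fun k => f k i) (fun k => Z.oneA (A k) i))) h) (md _ _)
  have e1 : ∀ᶠ k in l, ∀ i, d k (e k i) (Z.oneA (A k) i) = e k i := by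
    rw [eventually_all]
    intro i
    have h := hd.e1 i
    rw [rmk_one] at h
    exact req (fun k => d k (e k i) (Z.oneA (A k) i)) (fun k => e k i)
      (θ.symm (mt (fun k => e k i) (fun k => Z.oneA (A k) i))) (δ.trans (md _ _) (δ.symm h))
  have f0 : ∀ᶠ k in l, ∀ i, d k (f k i) (Z.zeroA (A k) i) = f k i := by
    rw [eventually_all]
    intro i
    have h := hd.f0 i
    rw [rmk_zero] at h
    exact req (fun k => d k (f k i) (Z.zeroA (A k) i)) (fun k => f k i)
      (θ.symm (mt (fun k => f k i) (fun k => Z.zeroA (A k) i))) (δ.trans (md _ _) (δ.symm h))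
  obtain ⟨k, k1, k2, k3, k4, k5, k6, k7, k8⟩ :=
    (D1.and (D2.and (D3.and (D4.and (e0.and (f1.and (e1.and f0))))))).exists
  refine ⟨k, (centDiamond_iff E Z (hA k) _ _).2 (dec_of_op Z (e k) (f k) (d k) k1
    (fun a b c => k2 (a, b, c)) (fun a b c => k3 (a, b, c))
    (fun m g x y => k4 ⟨m, g⟩ (x, y)) k5 k6 k7 k8)⟩

/-- The closed-term algebra in universe `u`. -/
def TermAlg (L : FirstOrder.Language.{0, 0}) : Type u := ULift.{u} (L.Term Empty)

instance termStr [L.IsAlgebraic] : L.Structure (TermAlg.{u} L) where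
  funMap := fun g x => ULift.up (Term.func g (fun i => (x i).down))
  RelMap := fun r => isEmptyElim r

/-- Evaluation of closed terms. -/
def termEval [L.IsAlgebraic] (A : Type u) [L.Structure A] : TermAlg.{u} L →[L] A :=
  mkHom (fun t => t.down.realize Empty.elim) (fun _ _ _ => rfl)

/-- Equality of closed terms in the variety. -/
def termCon [L.IsAlgebraic] (E : Set (Identity L)) : AlgCon L (TermAlg.{u} L) where
  r s t := ∀ (A : Type u) [L.Structure A], InVariety E A → termEval A s = termEval A t
  refl _ _ _ _ := rfl
  symm h A _ hA := (h A hA).symm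
  trans h1 h2 A _ hA := (h1 A hA).trans (h2 A hA)
  compat g x y h A _ hA := by
    rw [(termEval A).map_fun, (termEval A).map_fun]
    congr 1
    funext i
    exact h i A hA

/-- The initial algebra of the variety. -/
abbrev F0 [L.IsAlgebraic] (E : Set (Identity L)) : Type u := ConQuot (termCon.{u} E)

/-- The map from the initial algebra. -/
noncomputable def initHom [L.IsAlgebraic] (E : Set (Identity L)) (A : Type u) [L.Structure A]
    (hA : InVariety E A) : F0.{u} E →[L] A :=
  liftHom _ (termEval A) (fun _ _ h => h A hA)

theorem inVariety_F0 [L.IsAlgebraic] (E : Set (Identity L)) : InVariety E (F0.{u} E) := by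
  apply inVariety_of_sep
  intro x y h
  obtain ⟨s, rfl⟩ := quot_surj _ x
  obtain ⟨t, rfl⟩ := quot_surj _ y
  rw [quot_eq]
  intro A _ hA
  exact h A hA (initHom E A hA)

/-- The generic algebra with complementary central elements. -/
abbrev PP [L.IsAlgebraic] (E : Set (Identity L)) : Type u := F0.{u} E × F0.{u} E

/-- The generic `e`. -/
noncomputable def pe [L.IsAlgebraic] (E : Set (Identity L)) (Z : ZeroOneData L) (i : Fin Z.n) :
    PP.{u} E := (Z.zeroA _ i, Z.oneA _ i)

/-- The generic `f`. -/
noncomputable def pf [L.IsAlgebraic] (E : Set (Identity L)) (Z : ZeroOneData L) (i : Fin Z.n) :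
    PP.{u} E := (Z.oneA _ i, Z.zeroA _ i)

theorem inVariety_PP [L.IsAlgebraic] (E : Set (Identity L)) : InVariety E (PP.{u} E) := by
  apply inVariety_of_sep
  intro x y h
  exact Prod.ext (h _ (inVariety_F0 E) (fstHom _ _)) (h _ (inVariety_F0 E) (sndHom _ _))

theorem diamond_PP [L.IsAlgebraic] (E : Set (Identity L)) (Z : ZeroOneData L) :
    CentDiamond E Z (PP.{u} E) (pe E Z) (pf E Z) :=
  ⟨⟨⟨F0 E, F0 E, inVariety_F0 E, inVariety_F0 E, FirstOrder.Language.Equiv.refl L _,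
    fun _ => rfl⟩, fun _ => rfl⟩⟩

theorem hom_of_diamond [L.IsAlgebraic] (E : Set (Identity L)) (Z : ZeroOneData L) {A : Type u}
    [L.Structure A] (e f : Fin Z.n → A) (h : CentDiamond E Z A e f) :
    ∃ φ : PP.{u} E →[L] A, (∀ i, φ (pe E Z i) = e i) ∧ (∀ i, φ (pf E Z i) = f i) := by
  obtain ⟨⟨⟨A₁, A₂, m1, m2, iso, he⟩, hf⟩⟩ := h
  let ψ : PP.{u} E →[L] A₁ × A₂ :=
    mkHom (fun x => (initHom E A₁ m1 x.1, initHom E A₂ m2 x.2)) (by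
      intro m g x
      exact Prod.ext ((initHom E A₁ m1).map_fun g _) ((initHom E A₂ m2).map_fun g _))
  have hψ : ∀ x, ψ x = (initHom E A₁ m1 x.1, initHom E A₂ m2 x.2) := fun _ => rfl
  refine ⟨iso.symm.toHom.comp ψ, fun i => ?_, fun i => ?_⟩
  · show iso.symm (ψ _) = _
    rw [hψ]
    have h1 := hom_zero Z (initHom E A₁ m1) i
    have h2 := hom_one Z (initHom E A₂ m2) i
    simp only [pe]
    rw [h1, h2, ← he i]
    exact iso.symm_apply_apply _
  · show iso.symm (ψ _) = _
    rw [hψ]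
    have h1 := hom_one Z (initHom E A₁ m1) i
    have h2 := hom_zero Z (initHom E A₂ m2) i
    have h3 : iso (f i) = _ := hf i
    simp only [pf]
    rw [h1, h2]
    exact (congrArg iso.symm h3).symm.trans (iso.symm_apply_apply _)

/-- Satisfaction of the finite part of the diagram of the generic algebra given by `T`. -/
def SatT [L.IsAlgebraic] (E : Set (Identity L)) (Z : ZeroOneData L) (T : Finset (PP.{u} E))
    (A : Type u) [L.Structure A] (e f : Fin Z.n → A) : Prop :=
  ∃ w : T → A,
    (∀ (g : Σ n, L.Functions n) (c : Fin g.1 → T) (b : T),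
      (funMap g.2 (fun i => (c i : PP.{u} E)) = b) → funMap g.2 (fun i => w (c i)) = w b) ∧
    (∀ (i : Fin Z.n) (b : T), pe E Z i = b → w b = e i) ∧
    (∀ (i : Fin Z.n) (b : T), pf E Z i = b → w b = f i)

theorem satT_of_diamond [L.IsAlgebraic] (E : Set (Identity L)) (Z : ZeroOneData L)
    (T : Finset (PP.{u} E)) {A : Type u} [L.Structure A] (e f : Fin Z.n → A)
    (h : CentDiamond E Z A e f) : SatT E Z T A e f := by
  obtain ⟨φ, he, hf⟩ := hom_of_diamond E Z e f h
  refine ⟨fun c => φ c, ?_, ?_, ?_⟩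
  · intro g c b hb
    exact (φ.map_fun g.2 _).symm.trans (congrArg φ hb)
  · intro i b hb
    exact (congrArg φ hb).symm.trans (he i)
  · intro i b hb
    exact (congrArg φ hb).symm.trans (hf i)

theorem exists_T [L.IsAlgebraic] [Finite (Σ n, L.Functions n)]
    (E : Set (Identity L)) (Z : ZeroOneData L)
    (hsep : ZeroOneData.Separates.{u} Z E) (hbfc : HasBFC.{u} E)
    (hst : StableByComplements.{u} E Z) :
    ∃ T : Finset (PP.{u} E), ∀ (A : Type u) [L.Structure A], InVariety E A →
      ∀ e f : Fin Z.n → A, SatT E Z T A e f → CentDiamond E Z A e f := by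
  classical
  by_contra hcon
  push Not at hcon
  choose A sA hA e f hsat hbad using hcon
  choose w hw1 hw2 hw3 using hsat
  have hne : ∀ k, Nonempty (A k) := fun k => ⟨Z.zeroA (A k) ⟨0, Z.npos⟩⟩
  let W : ∀ T : Finset (PP.{u} E), PP.{u} E → A T := fun T c =>
    if h : c ∈ T then w T ⟨c, h⟩ else Classical.arbitrary _
  have hW : ∀ T c (h : c ∈ T), W T c = w T ⟨c, h⟩ := fun T c h => dif_pos h
  obtain ⟨T, hT⟩ := exists_of_red E Z hsep hbfc (atTop : Filter (Finset (PP.{u} E))) A hA e f (by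
    intro J κ l' hκ
    have hmem : ∀ c : PP.{u} E, ∀ᶠ j in l', c ∈ κ j := by
      intro c
      filter_upwards [hκ.eventually (eventually_ge_atTop {c})] with j hj
      exact hj (Finset.mem_singleton_self c)
    let φ : PP.{u} E →[L] Red L l' (fun j => A (κ j)) :=
      mkHom (fun c => rmk L l' (fun j => A (κ j)) (fun j => W (κ j) c)) (by
        intro m g x
        refine Eq.trans ?_ ((rmk L l' (fun j => A (κ j))).map_fun g
          (fun i j => W (κ j) (x i)))
        rw [rmk_eq]
        filter_upwards [hmem (funMap g x), eventually_all.2 fun i => hmem (x i)] with j h1 h2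
        rw [hW _ _ h1]
        show _ = funMap g (fun i => W (κ j) (x i))
        simp only [hW _ _ (h2 _)]
        exact (hw1 (κ j) ⟨m, g⟩ (fun i => ⟨x i, h2 i⟩) ⟨_, h1⟩ rfl).symm)
    have h := hst _ _ (inVariety_PP E) (inVariety_red E l' _ fun j => hA _) φ _ _
      (diamond_PP E Z)
    have he : (fun i => φ (pe E Z i)) =
        fun i => rmk L l' (fun j => A (κ j)) (fun j => e (κ j) i) := by
      funext i
      refine (rmk_eq _ _ _ _).2 ?_
      filter_upwards [hmem (pe E Z i)] with j h1
      rw [hW _ _ h1]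
      exact hw2 _ i _ rfl
    have hf : (fun i => φ (pf E Z i)) =
        fun i => rmk L l' (fun j => A (κ j)) (fun j => f (κ j) i) := by
      funext i
      refine (rmk_eq _ _ _ _).2 ?_
      filter_upwards [hmem (pf E Z i)] with j h1
      rw [hW _ _ h1]
      exact hw3 _ i _ rfl
    rw [he, hf] at h
    exact h)
  exact hbad T hT

/-- The finite part of the diagram as a list of equations. -/
theorem exists_eqs [L.IsAlgebraic] [Finite (Σ n, L.Functions n)]
    (E : Set (Identity L)) (Z : ZeroOneData L) (T : Finset (PP.{u} E)) :
    ∃ (m : ℕ) (eqs : List (L.Term ((Fin Z.n ⊕ Fin Z.n) ⊕ Fin m) ×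
        L.Term ((Fin Z.n ⊕ Fin Z.n) ⊕ Fin m))),
      ∀ (A : Type u) [L.Structure A], ∀ e f : Fin Z.n → A,
        (SatT E Z T A e f ↔ ∃ w : Fin m → A, ∀ p ∈ eqs,
          p.1.realize (Sum.elim (Sum.elim e f) w) =
            p.2.realize (Sum.elim (Sum.elim e f) w)) := by
  classical
  let idx : T ≃ Fin T.card := T.equivFin
  let I1 : Type u := {x : (Σ g : (Σ n, L.Functions n), (Fin g.1 → T) × T) //
    funMap x.1.2 (fun i => (x.2.1 i : PP.{u} E)) = x.2.2}
  let I2 : Type u := {x : Fin Z.n × T // pe E Z x.1 = x.2}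
  let I3 : Type u := {x : Fin Z.n × T // pf E Z x.1 = x.2}
  have : Finite I1 := inferInstance
  have : Finite I2 := inferInstance
  have : Finite I3 := inferInstance
  let V := (Fin Z.n ⊕ Fin Z.n) ⊕ Fin T.card
  let q : I1 ⊕ I2 ⊕ I3 → L.Term V × L.Term V := fun x => match x with
    | Sum.inl x => (Term.func x.1.1.2 (fun i => Term.var (Sum.inr (idx (x.1.2.1 i)))),
        Term.var (Sum.inr (idx x.1.2.2)))
    | Sum.inr (Sum.inl x) => (Term.var (Sum.inr (idx x.1.2)),
        Term.var (Sum.inl (Sum.inl x.1.1)))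
    | Sum.inr (Sum.inr x) => (Term.var (Sum.inr (idx x.1.2)),
        Term.var (Sum.inl (Sum.inr x.1.1)))
  have hfin : (Set.range q).Finite := Set.finite_range q
  refine ⟨T.card, hfin.toFinset.toList, ?_⟩
  intro A _ e f
  simp only [Finset.mem_toList, Set.Finite.mem_toFinset, Set.forall_mem_range]
  constructor
  · rintro ⟨w, h1, h2, h3⟩
    refine ⟨fun k => w (idx.symm k), ?_⟩
    rintro (⟨⟨g, c, b⟩, hx⟩ | ⟨⟨i, b⟩, hx⟩ | ⟨⟨i, b⟩, hx⟩)
    · simpa [q] using h1 g c b hx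
    · simpa [q] using h2 i b hx
    · simpa [q] using h3 i b hx
  · rintro ⟨w, hw⟩
    refine ⟨fun c => w (idx c), ?_, ?_, ?_⟩
    · intro g c b hx
      simpa [q] using hw (Sum.inl ⟨⟨g, c, b⟩, hx⟩)
    · intro i b hx
      simpa [q] using hw (Sum.inr (Sum.inl ⟨⟨i, b⟩, hx⟩))
    · intro i b hx
      simpa [q] using hw (Sum.inr (Sum.inr ⟨⟨i, b⟩, hx⟩))

end StabProof



/-- In a variety with 0⃗ and 1⃗ having BFC, definability of
`e⃗ ⋄_A f⃗` by a formula of the form ∃w⃗ ⋀ p ≈ q is equivalent to stability by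
complements. -/
theorem statement0 (L : FirstOrder.Language.{0, 0}) [L.IsAlgebraic]
    [Finite (Σ n, L.Functions n)]
    (E : Set (Identity L)) (Z : ZeroOneData L)
    (hsep : ZeroOneData.Separates.{u} Z E) (hbfc : HasBFC.{u} E) :
    (∃ (m : ℕ) (eqs : List (L.Term ((Fin Z.n ⊕ Fin Z.n) ⊕ Fin m) ×
        L.Term ((Fin Z.n ⊕ Fin Z.n) ⊕ Fin m))),
      ∀ (A : Type u) [L.Structure A], InVariety E A → ∀ e f : Fin Z.n → A,
        (CentDiamond E Z A e f ↔ ∃ w : Fin m → A, ∀ p ∈ eqs,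
          p.1.realize (Sum.elim (Sum.elim e f) w) =
            p.2.realize (Sum.elim (Sum.elim e f) w)))
    ↔ StableByComplements.{u} E Z := by
  constructor
  · rintro ⟨m, eqs, h⟩ A B _ _ hA hB φ e g hd
    obtain ⟨w, hw⟩ := (h A hA e g).1 hd
    refine (h B hB _ _).2 ⟨fun k => φ (w k), fun p hp => ?_⟩
    have hv : Sum.elim (Sum.elim (fun i => φ (e i)) (fun i => φ (g i))) (fun k => φ (w k)) =
        φ ∘ Sum.elim (Sum.elim e g) w := by
      funext x
      rcases x with (x | x) | x <;> rfl
    rw [hv, HomClass.realize_term φ, HomClass.realize_term φ, hw p hp]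
  · intro hst
    obtain ⟨T, hT⟩ := StabProof.exists_T E Z hsep hbfc hst
    obtain ⟨m, eqs, h⟩ := StabProof.exists_eqs E Z T
    refine ⟨m, eqs, fun A _ hA e f => ?_⟩
    rw [← h A e f]
    exact ⟨StabProof.satT_of_diamond E Z T e f, hT A hA e f⟩
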